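/- Assume the Riemann hypothesis. Then for every δ > 0 and every real p > 1 there exist constants C > 0 and T₀ ≥ 16 such that for all T ≥ T₀, ∫_T^{T+δ} |ζ(1+it)|^{−p} dt ≤ C · (log log log T) · (log log T)^{p−1}. -/

import Mathlib

open Complex Real Filter MeasureTheory intervalIntegral

lemma mellin_indicator_fract_differentiableAt {s : ℂ} (hs : 0 < s.re) :
    DifferentiableAt ℂ
      (mellin ((Set.Ioi (1 : ℝ)).indicator fun t ↦ ((Int.fract t : ℝ) : ℂ))) (-s) := by
  have hmeas : Measurable ((Set.Ioi (1 : ℝ)).indicator fun t ↦ ((Int.fract t : ℝ) : ℂ)) :=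
    (Complex.measurable_ofReal.comp measurable_fract).indicator measurableSet_Ioi
  have hbd (t : ℝ) : ‖(Set.Ioi (1 : ℝ)).indicator (fun t ↦ ((Int.fract t : ℝ) : ℂ)) t‖ ≤ 1 := by
    refine (norm_indicator_le_norm_self _ _).trans ?_
    rw [Complex.norm_real, Real.norm_of_nonneg (Int.fract_nonneg t)]
    exact (Int.fract_lt_one t).le
  refine mellin_differentiableAt_of_isBigO_rpow (a := 0) (b := -s.re - 1) ?_ ?_ (by simpa) ?_
    (by simp)
  · refine LocallyIntegrable.locallyIntegrableOn ?_ _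
    exact (locallyIntegrable_const (1 : ℝ)).mono hmeas.aestronglyMeasurable
      (.of_forall fun t ↦ by simpa using hbd t)
  · exact Asymptotics.IsBigO.of_bound 1 (.of_forall fun t ↦ by simpa using hbd t)
  · refine Asymptotics.IsBigO.of_bound 1 ?_
    filter_upwards [mem_nhdsWithin_of_mem_nhds (Iio_mem_nhds (zero_lt_one (α := ℝ)))] with t ht
    rw [Set.indicator_of_notMem (by simpa using ht.le)]
    simp

lemma mellin_indicator_fract_neg (s : ℂ) :
    mellin ((Set.Ioi (1 : ℝ)).indicator fun t ↦ ((Int.fract t : ℝ) : ℂ)) (-s)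
      = ∫ t in Set.Ioi (1 : ℝ), (t : ℂ) ^ (-s - 1) * ((Int.fract t : ℝ) : ℂ) := by
  rw [mellin, ← MeasureTheory.integral_indicator measurableSet_Ioi,
    ← MeasureTheory.integral_indicator measurableSet_Ioi]
  congr 1 with t
  by_cases h : t ∈ Set.Ioi (1 : ℝ)
  · rw [Set.indicator_of_mem (Set.Ioi_subset_Ioi zero_le_one h), Set.indicator_of_mem h,
      Set.indicator_of_mem h, smul_eq_mul]
  · rw [Set.indicator_of_notMem h, Set.indicator_apply, Set.indicator_of_notMem h, smul_zero,
      ite_self]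

lemma norm_mellin_indicator_fract_le {s : ℂ} (hs : 0 < s.re) :
    ‖mellin ((Set.Ioi (1 : ℝ)).indicator fun t ↦ ((Int.fract t : ℝ) : ℂ)) (-s)‖ ≤ 1 / s.re := by
  rw [mellin_indicator_fract_neg]
  calc _ ≤ ∫ t in Set.Ioi (1 : ℝ), t ^ (-s.re - 1) := by
        refine norm_integral_le_of_norm_le (integrableOn_Ioi_rpow_of_lt (by linarith) one_pos) ?_
        filter_upwards [ae_restrict_mem measurableSet_Ioi] with t ht
        have ht' : 0 < t := one_pos.trans ht
        rw [norm_mul, Complex.norm_cpow_eq_rpow_re_of_pos ht', Complex.norm_real,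
          Real.norm_of_nonneg (Int.fract_nonneg t)]
        simpa using mul_le_mul_of_nonneg_left (Int.fract_lt_one t).le
          (Real.rpow_nonneg ht'.le (-s.re - 1))
    _ = 1 / s.re := by
        rw [integral_Ioi_rpow_of_lt (by linarith) one_pos]
        simp

lemma riemannZeta₀_eq_of_one_lt_re {s : ℂ} (hs : 1 < s.re) :
    riemannZeta₀ s
      = 1 - s * mellin ((Set.Ioi (1 : ℝ)).indicator fun t ↦ ((Int.fract t : ℝ) : ℂ)) (-s) := by
  have hs1 : s ≠ 1 := by rintro rfl; simp at hs
  have hs1' : s - 1 ≠ 0 := sub_ne_zero.2 hs1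
  have hs0 : s ≠ 0 := by rintro rfl; simp at hs; linarith
  have hsum (n : ℕ) : ∑ k ∈ Finset.Icc 1 n, (1 : ℕ → ℂ) k = n := by simp
  have hL := LSeries_eq_mul_integral' 1 zero_le_one hs (by
    refine Asymptotics.IsBigO.of_bound 1 (.of_forall fun n ↦ ?_)
    simp)
  rw [show LSeries 1 s = riemannZeta s from LSeries_one_eq_riemannZeta hs] at hL
  have hpow : ∫ t in Set.Ioi (1 : ℝ), (t : ℂ) ^ (-s) = 1 / (s - 1) := by
    rw [integral_Ioi_cpow_of_lt (by simpa using hs) one_pos, Complex.ofReal_one, Complex.one_cpow,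
      show -s + 1 = -(s - 1) by ring, neg_div_neg_eq]
  have hint : IntegrableOn (fun t : ℝ ↦ (t : ℂ) ^ (-s)) (Set.Ioi 1) :=
    integrableOn_Ioi_cpow_of_lt (by simpa using hs) one_pos
  have hint' : IntegrableOn (fun t : ℝ ↦ (t : ℂ) ^ (-s - 1) * ((Int.fract t : ℝ) : ℂ))
      (Set.Ioi 1) := by
    refine Integrable.mul_bdd (c := 1) (integrableOn_Ioi_cpow_of_lt (by simp; linarith) one_pos)
      (Complex.measurable_ofReal.comp measurable_fract).aestronglyMeasurable (.of_forall fun t ↦ ?_)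
    rw [Complex.norm_real, Real.norm_of_nonneg (Int.fract_nonneg t)]
    exact (Int.fract_lt_one t).le
  have hsplit : ∫ t in Set.Ioi (1 : ℝ),
      (∑ k ∈ Finset.Icc 1 ⌊t⌋₊, (1 : ℕ → ℂ) k) * (t : ℂ) ^ (-(s + 1))
      = 1 / (s - 1) - ∫ t in Set.Ioi (1 : ℝ), (t : ℂ) ^ (-s - 1) * ((Int.fract t : ℝ) : ℂ) := by
    rw [← hpow, ← MeasureTheory.integral_sub hint hint']
    refine setIntegral_congr_fun measurableSet_Ioi fun t ht ↦ ?_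
    have ht0 : (0 : ℝ) < t := one_pos.trans ht
    have htc : (t : ℂ) ≠ 0 := by exact_mod_cast ht0.ne'
    have hfl : ((⌊t⌋₊ : ℕ) : ℂ) = t - ((Int.fract t : ℝ) : ℂ) := by
      rw [← Complex.ofReal_natCast, natCast_floor_eq_intCast_floor ht0.le, ← Complex.ofReal_sub,
        Int.self_sub_fract]
    have hp : (t : ℂ) ^ (-s) = (t : ℂ) ^ (-s - 1) * t := by
      rw [Complex.cpow_sub _ _ htc, Complex.cpow_one, div_mul_cancel₀ _ htc]
    simp only [hsum, hfl, hp, show -(s + 1) = -s - 1 by ring]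
    ring
  rw [mellin_indicator_fract_neg, ← sub_eq_iff_eq_add'.2 (riemannZeta_eq_inv_sub_add hs1), hL,
    hsplit]
  field_simp
  ring

lemma riemannZeta₀_eq {s : ℂ} (hs : 0 < s.re) :
    riemannZeta₀ s
      = 1 - s * mellin ((Set.Ioi (1 : ℝ)).indicator fun t ↦ ((Int.fract t : ℝ) : ℂ)) (-s) := by
  have hU : IsOpen {s : ℂ | 0 < s.re} := isOpen_lt continuous_const Complex.continuous_re
  have h2 : AnalyticOnNhd ℂ (fun s ↦ 1 - s *
      mellin ((Set.Ioi (1 : ℝ)).indicator fun t ↦ ((Int.fract t : ℝ) : ℂ)) (-s))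
      {s : ℂ | 0 < s.re} := by
    refine DifferentiableOn.analyticOnNhd (fun s hs ↦ ?_) hU
    have := (mellin_indicator_fract_differentiableAt hs).comp s differentiableAt_id.neg
    exact ((differentiableAt_const _).sub
      (differentiableAt_id.mul this)).differentiableWithinAt
  have h1 : AnalyticOnNhd ℂ riemannZeta₀ {s : ℂ | 0 < s.re} :=
    differentiable_riemannZeta₀.differentiableOn.analyticOnNhd hU
  refine h1.eqOn_of_preconnected_of_eventuallyEq h2
    (convex_halfSpace_re_gt 0).isPreconnected (z₀ := 2) (by simp) ?_ hs
  filter_upwards [(isOpen_lt continuous_const Complex.continuous_re).mem_nhds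
    (show (1 : ℝ) < (2 : ℂ).re by simp)] with z hz using riemannZeta₀_eq_of_one_lt_re hz

/-- The regular part of `ζ` at `1` grows at most linearly on the half-plane `1 / 2 ≤ re s`. -/
lemma norm_riemannZeta₀_le {s : ℂ} (hs : 1 / 2 ≤ s.re) : ‖riemannZeta₀ s‖ ≤ 1 + 2 * ‖s‖ := by
  have h0 : 0 < s.re := by linarith
  rw [riemannZeta₀_eq h0]
  refine (norm_sub_le _ _).trans ?_
  rw [norm_one, norm_mul, mul_comm 2]
  gcongr
  refine (norm_mellin_indicator_fract_le h0).trans ?_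
  rw [div_le_iff₀ h0]; linarith


section Majorant

open scoped BoundedContinuousFunction

/-- `g` majorizes `f` with respect to `μ` if every Fourier coefficient of `f μ` is bounded in norm
by the real part of the corresponding coefficient of `g μ`. -/
def FourierMajorizes (μ : Measure ℝ) (f g : ℝ →ᵇ ℂ) : Prop :=
  ∀ l : ℝ, ‖∫ t, (f * BoundedContinuousFunction.innerProbChar l) t ∂μ‖
    ≤ (∫ t, (g * BoundedContinuousFunction.innerProbChar l) t ∂μ).re

variable {μ : Measure ℝ}

lemma continuous_integral_mul_boundedContinuous [IsFiniteMeasure μ] (h : ℝ →ᵇ ℂ) :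
    Continuous fun f : ℝ →ᵇ ℂ ↦ ∫ t, (f * h) t ∂μ := by
  have hlip : LipschitzWith (μ.real Set.univ).toNNReal fun f : ℝ →ᵇ ℂ ↦ ∫ t, f t ∂μ := by
    refine LipschitzWith.of_dist_le_mul fun f g ↦ ?_
    rw [dist_eq_norm, dist_eq_norm, ← integral_sub (f.integrable μ) (g.integrable μ),
      Real.coe_toNNReal _ measureReal_nonneg]
    exact (f - g).norm_integral_le_mul_norm μ
  exact hlip.continuous.comp (by fun_prop)

namespace FourierMajorizes

lemma zero : FourierMajorizes μ 0 0 := fun l ↦ by simp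

lemma add [IsFiniteMeasure μ] {f g f' g' : ℝ →ᵇ ℂ} (h : FourierMajorizes μ f g)
    (h' : FourierMajorizes μ f' g') :
    FourierMajorizes μ (f + f') (g + g') := fun l ↦ by
  simp only [add_mul, BoundedContinuousFunction.add_apply]
  rw [integral_add (BoundedContinuousFunction.integrable μ _)
    (BoundedContinuousFunction.integrable μ _), integral_add
    (BoundedContinuousFunction.integrable μ _) (BoundedContinuousFunction.integrable μ _),
    Complex.add_re]
  exact (norm_add_le _ _).trans (add_le_add (h l) (h' l))

lemma smul {f g : ℝ →ᵇ ℂ} (h : FourierMajorizes μ f g) {c : ℂ} {r : ℝ} (hc : ‖c‖ ≤ r) :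
    FourierMajorizes μ (c • f) ((r : ℂ) • g) := fun l ↦ by
  simp only [smul_mul_assoc, BoundedContinuousFunction.smul_apply, smul_eq_mul]
  rw [MeasureTheory.integral_const_mul, MeasureTheory.integral_const_mul, norm_mul,
    Complex.re_ofReal_mul]
  exact mul_le_mul hc (h l) (norm_nonneg _) ((norm_nonneg _).trans hc)

lemma innerProbChar_mul {f g : ℝ →ᵇ ℂ} (h : FourierMajorizes μ f g) (l : ℝ) :
    FourierMajorizes μ (BoundedContinuousFunction.innerProbChar l * f)
      (BoundedContinuousFunction.innerProbChar l * g) := fun m ↦ by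
  have key (f : ℝ →ᵇ ℂ) : BoundedContinuousFunction.innerProbChar l * f *
      BoundedContinuousFunction.innerProbChar m
      = f * BoundedContinuousFunction.innerProbChar (l + m) := by
    ext t
    simp only [BoundedContinuousFunction.mul_apply, BoundedContinuousFunction.innerProbChar_apply,
      inner_add_right, Complex.ofReal_add, add_mul, Complex.exp_add]
    ring
  rw [key, key]
  exact h _

lemma star {f g : ℝ →ᵇ ℂ} (h : FourierMajorizes μ f g) :
    FourierMajorizes μ (star f) (star g) := fun l ↦ by
  have key (f : ℝ →ᵇ ℂ) : ∫ t, (Star.star f * BoundedContinuousFunction.innerProbChar l) t ∂μ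
      = (starRingEnd ℂ) (∫ t, (f * BoundedContinuousFunction.innerProbChar (-l)) t ∂μ) := by
    rw [← integral_conj]
    congr 1 with t
    simp [BoundedContinuousFunction.innerProbChar_apply, ← Complex.exp_conj]
  rw [key, key, Complex.norm_conj, Complex.conj_re]
  exact h _

end FourierMajorizes

variable (μ) in
/-- The pairs `(u, v)` such that multiplication by `u` and `v` preserves `FourierMajorizes μ`. -/
def majorantSemiring [IsFiniteMeasure μ] : Subsemiring ((ℝ →ᵇ ℂ) × (ℝ →ᵇ ℂ)) where
  carrier := {z | ∀ f g, FourierMajorizes μ f g → FourierMajorizes μ (z.1 * f) (z.2 * g)}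
  mul_mem' {a b} ha hb f g h := by
    simpa only [Prod.fst_mul, Prod.snd_mul, mul_assoc] using ha _ _ (hb _ _ h)
  one_mem' f g h := by simpa using h
  add_mem' {a b} ha hb f g h := by
    simpa only [Prod.fst_add, Prod.snd_add, add_mul] using (ha _ _ h).add (hb _ _ h)
  zero_mem' f g h := by simpa using FourierMajorizes.zero

namespace majorantSemiring

lemma isClosed [IsFiniteMeasure μ] : IsClosed (majorantSemiring μ : Set ((ℝ →ᵇ ℂ) × (ℝ →ᵇ ℂ))) := by
  change IsClosed {z : (ℝ →ᵇ ℂ) × (ℝ →ᵇ ℂ) |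
    ∀ f g, FourierMajorizes μ f g → FourierMajorizes μ (z.1 * f) (z.2 * g)}
  simp only [FourierMajorizes, Set.ofPred_forall]
  refine isClosed_iInter fun f ↦ isClosed_iInter fun g ↦ isClosed_iInter fun _ ↦
    isClosed_iInter fun l ↦ isClosed_le ?_ ?_
  · exact ((continuous_integral_mul_boundedContinuous _).comp
      (continuous_fst.mul continuous_const)).norm
  · exact Complex.continuous_re.comp ((continuous_integral_mul_boundedContinuous _).comp
      (continuous_snd.mul continuous_const))

lemma hasSum_mem [IsFiniteMeasure μ] {ι : Type*} {u v : ι → ℝ →ᵇ ℂ} {U V : ℝ →ᵇ ℂ}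
    (h : ∀ i, (u i, v i) ∈ majorantSemiring μ) (hu : HasSum u U) (hv : HasSum v V) :
    (U, V) ∈ majorantSemiring μ :=
  isClosed.mem_of_tendsto (HasSum.prodMk hu hv)
    (.of_forall fun _ ↦ sum_mem fun i _ ↦ h i)

lemma smul_mem [IsFiniteMeasure μ] {u v : ℝ →ᵇ ℂ} (h : (u, v) ∈ majorantSemiring μ)
    {c : ℂ} {r : ℝ} (hc : ‖c‖ ≤ r) :
    (c • u, (r : ℂ) • v) ∈ majorantSemiring μ := fun f g hfg ↦ by
  simpa only [smul_mul_assoc] using (h f g hfg).smul hc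

lemma innerProbChar_mem [IsFiniteMeasure μ] (l : ℝ) : (BoundedContinuousFunction.innerProbChar l,
    BoundedContinuousFunction.innerProbChar l) ∈ majorantSemiring μ :=
  fun _ _ hfg ↦ hfg.innerProbChar_mul l

lemma star_mem [IsFiniteMeasure μ] {u v : ℝ →ᵇ ℂ} (h : (u, v) ∈ majorantSemiring μ) :
    (star u, star v) ∈ majorantSemiring μ := fun f g hfg ↦ by
  simpa only [star_mul', star_star] using (h _ _ hfg.star).star

lemma exp_mem [IsFiniteMeasure μ] {u v : ℝ →ᵇ ℂ} (h : (u, v) ∈ majorantSemiring μ) :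
    (NormedSpace.exp u, NormedSpace.exp v) ∈ majorantSemiring μ := by
  refine hasSum_mem (fun n : ℕ ↦ ?_) (NormedSpace.exp_series_hasSum_exp' (𝕂 := ℂ) u)
    (NormedSpace.exp_series_hasSum_exp' (𝕂 := ℂ) v)
  have := smul_mem (pow_mem h n) (c := ((n.factorial : ℂ))⁻¹) (r := (n.factorial : ℝ)⁻¹) (by simp)
  simpa using this

lemma norm_integral_le [IsFiniteMeasure μ] {u v : ℝ →ᵇ ℂ} (h : (u, v) ∈ majorantSemiring μ)
    (hμ : ∀ l, ‖charFun μ l‖ ≤ (charFun μ l).re) : ‖∫ t, u t ∂μ‖ ≤ (∫ t, v t ∂μ).re := by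
  have h1 : FourierMajorizes μ 1 1 := fun l ↦ by
    simpa [charFun_eq_integral_innerProbChar] using hμ l
  simpa using h 1 1 h1 0

end majorantSemiring

lemma boundedContinuous_exp_apply (u : ℝ →ᵇ ℂ) (t : ℝ) :
    NormedSpace.exp u t = Complex.exp (u t) := by
  have h := (NormedSpace.exp_series_hasSum_exp' (𝕂 := ℂ) u).mapL
    (BoundedContinuousFunction.evalCLM ℂ t)
  rw [Complex.exp_eq_exp_ℂ]
  refine h.unique ?_
  simpa using NormedSpace.exp_series_hasSum_exp' (𝕂 := ℂ) (u t)

end Majorant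

section ZetaMajorant

open scoped BoundedContinuousFunction

lemma term_add_mul_I (f : ℕ → ℂ) (s : ℂ) (t : ℝ) (n : ℕ) :
    LSeries.term f (s + t * Complex.I) n
      = LSeries.term f s n * BoundedContinuousFunction.innerProbChar (-Real.log n) t := by
  rcases eq_or_ne n 0 with rfl | hn
  · simp
  have hn' : (n : ℂ) ≠ 0 := by exact_mod_cast hn
  rw [LSeries.term_of_ne_zero hn, LSeries.term_of_ne_zero hn, Complex.cpow_add _ _ hn',
    div_mul_eq_div_div, div_eq_mul_inv _ ((n : ℂ) ^ ((t : ℂ) * Complex.I)), ← Complex.cpow_neg,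
    Complex.cpow_def_of_ne_zero hn' (-_),
    BoundedContinuousFunction.innerProbChar_apply, ← Complex.natCast_log]
  congr 2
  simp
  ring

/-- The bounded continuous function `t ↦ LSeries f (s + t * I)`. -/
noncomputable def lSeriesBCF (f : ℕ → ℂ) (s : ℂ) : ℝ →ᵇ ℂ :=
  ∑' n, LSeries.term f s n • BoundedContinuousFunction.innerProbChar (-Real.log n)

lemma norm_innerProbChar_le (l : ℝ) :
    ‖(BoundedContinuousFunction.innerProbChar l : ℝ →ᵇ ℂ)‖ ≤ 1 :=
  (BoundedContinuousFunction.norm_le zero_le_one).2 fun t ↦ by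
    rw [BoundedContinuousFunction.innerProbChar_apply, Complex.norm_exp_ofReal_mul_I]

lemma hasSum_lSeriesBCF {f : ℕ → ℂ} {s : ℂ} (hf : LSeriesSummable f s) :
    HasSum (fun n ↦ LSeries.term f s n • BoundedContinuousFunction.innerProbChar (-Real.log n))
      (lSeriesBCF f s) := by
  refine (Summable.of_norm_bounded hf.norm fun n ↦ ?_).hasSum
  rw [norm_smul]
  exact mul_le_of_le_one_right (norm_nonneg _) (norm_innerProbChar_le _)

lemma lSeriesBCF_apply {f : ℕ → ℂ} {s : ℂ} (hf : LSeriesSummable f s) (t : ℝ) :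
    lSeriesBCF f s t = LSeries f (s + t * Complex.I) := by
  have h : HasSum (LSeries.term f (s + t * Complex.I)) (lSeriesBCF f s t) := by
    simpa [← term_add_mul_I] using
      (hasSum_lSeriesBCF hf).mapL (BoundedContinuousFunction.evalCLM ℂ t)
  exact h.tsum_eq.symm

lemma lSeriesBCF_mem_majorantSemiring {μ : Measure ℝ} [IsFiniteMeasure μ] {f : ℕ → ℂ} {σ : ℝ}
    (hf : LSeriesSummable f σ) (h0 : ∀ n, f n = ‖f n‖) (T : ℝ) :
    (lSeriesBCF f (σ + T * Complex.I), lSeriesBCF f σ) ∈ majorantSemiring μ := by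
  have hfT : LSeriesSummable f (σ + T * Complex.I) :=
    (LSeriesSummable_iff_of_re_eq_re (by simp)).1 hf
  refine majorantSemiring.hasSum_mem (fun n ↦ ?_) (hasSum_lSeriesBCF hfT) (hasSum_lSeriesBCF hf)
  have hterm : LSeries.term f σ n = (‖LSeries.term f σ n‖ : ℝ) := by
    rcases eq_or_ne n 0 with rfl | hn
    · simp
    rw [LSeries.norm_term_eq, if_neg hn, LSeries.term_of_ne_zero hn, h0, Complex.ofReal_div,
      Complex.ofReal_re, Complex.ofReal_cpow (Nat.cast_nonneg n), Complex.ofReal_natCast]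
    simp
  rw [hterm]
  refine majorantSemiring.smul_mem (majorantSemiring.innerProbChar_mem _) ?_
  simp [LSeries.norm_term_eq]

lemma lSeriesSummable_vonMangoldt_div_log {σ : ℝ} (hσ : 1 < σ) :
    LSeriesSummable (fun n ↦ ArithmeticFunction.vonMangoldt n / Real.log n) σ := by
  refine LSeriesSummable_of_le_const_mul_rpow (x := 1) (by simpa) ⟨1, fun n hn ↦ ?_⟩
  have h := Real.log_natCast_nonneg n
  simp only [← Complex.ofReal_div, Complex.norm_real, sub_self, Real.rpow_zero, mul_one]
  rw [Real.norm_of_nonneg (div_nonneg ArithmeticFunction.vonMangoldt_nonneg h)]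
  exact div_le_one_of_le₀ ArithmeticFunction.vonMangoldt_le_log h

/-- Majorant principle for negative powers of `ζ`: for a measure whose characteristic function is
nonnegative, moments of `1 / ζ` on a shifted vertical line are at most those of `ζ` on the
unshifted line. -/
lemma integral_norm_riemannZeta_rpow_neg_le {μ : Measure ℝ} [IsFiniteMeasure μ]
    (hμ : ∀ l, ‖charFun μ l‖ ≤ (charFun μ l).re) {σ : ℝ} (hσ : 1 < σ) {p : ℝ} (hp : 0 ≤ p) (T : ℝ) :
    Integrable (fun t ↦ ‖riemannZeta (σ + (T + t : ℝ) * Complex.I)‖ ^ (-p)) μ ∧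
      ∫ t, ‖riemannZeta (σ + (T + t : ℝ) * Complex.I)‖ ^ (-p) ∂μ
        ≤ ∫ t, ‖riemannZeta (σ + (t : ℝ) * Complex.I)‖ ^ p ∂μ := by
  set f : ℕ → ℂ := fun n ↦ ArithmeticFunction.vonMangoldt n / Real.log n with hf
  have h0 (n : ℕ) : f n = ‖f n‖ := by
    have : 0 ≤ ArithmeticFunction.vonMangoldt n / Real.log n :=
      div_nonneg ArithmeticFunction.vonMangoldt_nonneg (Real.log_natCast_nonneg n)
    simp only [hf, ← Complex.ofReal_div, Complex.norm_real, Real.norm_of_nonneg this]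
  have hs : LSeriesSummable f σ := lSeriesSummable_vonMangoldt_div_log hσ
  have hsT : LSeriesSummable f (σ + T * Complex.I) :=
    (LSeriesSummable_iff_of_re_eq_re (by simp)).1 hs
  have hnorm (c : ℝ) (z : ℂ) (hz : 1 < z.re) :
      (starRingEnd ℂ) (Complex.exp (((c / 2 : ℝ) : ℂ) * LSeries f z)) *
        Complex.exp (((c / 2 : ℝ) : ℂ) * LSeries f z) = ((‖riemannZeta z‖ ^ c : ℝ) : ℂ) := by
    have hz' : riemannZeta z = Complex.exp (LSeries f z) := (riemannZeta_eq_exp_LSeries hz).symm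
    rw [hz', Complex.norm_exp, ← Real.exp_mul, mul_comm,
      Complex.mul_conj, Complex.normSq_eq_norm_sq, Complex.norm_exp, Complex.re_ofReal_mul,
      ← Real.exp_nat_mul]
    congr 2
    rw [Nat.cast_ofNat]
    ring
  have hmem := lSeriesBCF_mem_majorantSemiring (μ := μ) hs h0 T
  have hmem' := majorantSemiring.exp_mem (majorantSemiring.smul_mem hmem
    (c := ((-p / 2 : ℝ) : ℂ)) (r := p / 2) (by
      rw [Complex.norm_real, Real.norm_eq_abs, neg_div, abs_neg, abs_of_nonneg (by positivity)]))
  have hint : Integrable (fun t ↦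
      (star (NormedSpace.exp (((-p / 2 : ℝ) : ℂ) • lSeriesBCF f (σ + T * Complex.I))) *
        NormedSpace.exp (((-p / 2 : ℝ) : ℂ) • lSeriesBCF f (σ + T * Complex.I))) t) μ :=
    BoundedContinuousFunction.integrable μ _
  have key := majorantSemiring.norm_integral_le (u := star _ * _) (v := star _ * _)
    (mul_mem (majorantSemiring.star_mem hmem') hmem') hμ
  simp only [BoundedContinuousFunction.mul_apply, BoundedContinuousFunction.star_apply,
    boundedContinuous_exp_apply, BoundedContinuousFunction.smul_apply, smul_eq_mul,
    lSeriesBCF_apply hs, lSeriesBCF_apply hsT, RCLike.star_def] at key hint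
  have e1 (t : ℝ) := hnorm (-p) (σ + T * Complex.I + t * Complex.I) (by simpa)
  have e2 (t : ℝ) := hnorm p (σ + t * Complex.I) (by simpa)
  have e3 (t : ℝ) : (σ + (T + t : ℝ) * Complex.I : ℂ) = σ + T * Complex.I + t * Complex.I := by
    push_cast
    ring
  simp only [e1, e2] at key hint
  rw [integral_complex_ofReal, integral_complex_ofReal, Complex.ofReal_re, Complex.norm_real]
    at key
  simp only [e3]
  exact ⟨by simpa using hint.re, (Real.le_norm_self _).trans key⟩

end ZetaMajorant

section GaussianAverage

open ProbabilityTheory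

lemma norm_charFun_gaussianReal_zero_le_re (v : NNReal) (l : ℝ) :
    ‖charFun (gaussianReal 0 v) l‖ ≤ (charFun (gaussianReal 0 v) l).re := by
  have h : charFun (gaussianReal 0 v) l = (Real.exp (-(v * l ^ 2 / 2)) : ℝ) := by
    rw [charFun_gaussianReal]
    push_cast
    ring_nf
  rw [h, Complex.norm_real, Complex.ofReal_re, Real.norm_of_nonneg (Real.exp_nonneg _)]

lemma integrable_add_abs_rpow_neg {p : ℝ} (hp : 1 < p) {η : ℝ} (hη : 0 < η) :
    Integrable (fun t : ℝ ↦ (η + |t|) ^ (-p)) ∧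
      ∫ t : ℝ, (η + |t|) ^ (-p) = η ^ (1 - p) * ∫ t : ℝ, (1 + ‖t‖) ^ (-p) := by
  have h1 : Integrable (fun t : ℝ ↦ (1 + ‖t‖) ^ (-p)) := integrable_one_add_norm (by simpa)
  have h (t : ℝ) : (η + |t|) ^ (-p) = η ^ (-p) * (1 + ‖t / η‖) ^ (-p) := by
    rw [← Real.mul_rpow hη.le (by positivity), norm_div, Real.norm_of_nonneg hη.le,
      Real.norm_eq_abs, mul_add, mul_div_cancel₀ _ hη.ne', mul_one]
  simp_rw [h]
  refine ⟨(h1.comp_div hη.ne').const_mul _, ?_⟩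
  rw [MeasureTheory.integral_const_mul, Measure.integral_comp_div (fun t : ℝ ↦ (1 + ‖t‖) ^ (-p)),
    smul_eq_mul, abs_of_pos hη, ← mul_assoc, sub_eq_neg_add, Real.rpow_add hη, Real.rpow_one]

lemma gaussianPDFReal_zero_one_le_one (t : ℝ) : gaussianPDFReal 0 1 t ≤ 1 := by
  rw [gaussianPDFReal_def]
  refine mul_le_one₀ (inv_le_one_of_one_le₀ (Real.one_le_sqrt.2 ?_)) (Real.exp_nonneg _)
    (Real.exp_le_one_iff.2 ?_)
  · rw [NNReal.coe_one, mul_one]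
    linarith [Real.pi_gt_three]
  · rw [neg_div]
    exact neg_nonpos.2 (by positivity)

lemma integrable_gaussianReal_iff {f : ℝ → ℝ} :
    Integrable f (gaussianReal 0 1) ↔ Integrable fun t ↦ gaussianPDFReal 0 1 t * f t := by
  rw [gaussianReal_of_var_ne_zero _ one_ne_zero, integrable_withDensity_iff_integrable_smul'
    (measurable_gaussianPDF _ _) (ae_of_all _ fun _ ↦ gaussianPDF_lt_top)]
  simp [toReal_gaussianPDF]

/-- An interval integral of a nonnegative function is controlled by its Gaussian average. -/
lemma intervalIntegral_le_integral_gaussianReal {δ : ℝ} (hδ : 0 ≤ δ) {f : ℝ → ℝ} (hf : 0 ≤ f)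
    (hfi : Integrable f (gaussianReal 0 1)) :
    ∫ t in 0..δ, f t ≤ √(2 * Real.pi) * Real.exp (δ ^ 2 / 2) * ∫ t, f t ∂gaussianReal 0 1 := by
  have hfi' := integrable_gaussianReal_iff.1 hfi
  rw [integral_gaussianReal_eq_integral_smul one_ne_zero, ← MeasureTheory.integral_const_mul,
    intervalIntegral.integral_of_le hδ]
  refine le_trans ?_ (setIntegral_le_integral (hfi'.const_mul _) (s := Set.Ioc 0 δ)
    (ae_of_all _ fun t ↦ ?_))
  · refine integral_mono_of_nonneg (ae_of_all _ hf) (hfi'.const_mul _).restrict ?_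
    refine (ae_restrict_iff' measurableSet_Ioc).2 (ae_of_all _ fun t ht ↦ ?_)
    rw [gaussianPDFReal_def]
    have hpi : 0 < √(2 * Real.pi) := by positivity
    have h1 : 1 ≤ Real.exp (δ ^ 2 / 2) * Real.exp (-t ^ 2 / 2) := by
      rw [← Real.exp_add, Real.one_le_exp_iff]
      nlinarith [ht.1, ht.2]
    calc f t ≤ (Real.exp (δ ^ 2 / 2) * Real.exp (-t ^ 2 / 2)) * f t :=
          le_mul_of_one_le_left (hf t) h1
      _ = _ := by
        simp only [NNReal.coe_one, mul_one, sub_zero, smul_eq_mul]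
        field_simp
  · have := gaussianPDFReal_nonneg 0 1 t
    have := hf t
    simp only [Pi.zero_apply] at *
    positivity

lemma integral_add_abs_rpow_neg_gaussianReal_le {p : ℝ} (hp : 1 < p) {η : ℝ} (hη : 0 < η) :
    Integrable (fun t : ℝ ↦ (η + |t|) ^ (-p)) (gaussianReal 0 1) ∧
      ∫ t : ℝ, (η + |t|) ^ (-p) ∂gaussianReal 0 1
        ≤ η ^ (1 - p) * ∫ t : ℝ, (1 + ‖t‖) ^ (-p) := by
  obtain ⟨hi, he⟩ := integrable_add_abs_rpow_neg hp hη
  have h0 (t : ℝ) : 0 ≤ (η + |t|) ^ (-p) := by positivity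
  have hi' : Integrable fun t ↦ gaussianPDFReal 0 1 t * (η + |t|) ^ (-p) :=
    hi.mono' ((measurable_gaussianPDFReal 0 1).aestronglyMeasurable.mul hi.aestronglyMeasurable)
      (ae_of_all _ fun t ↦ by
        rw [Real.norm_of_nonneg (mul_nonneg (gaussianPDFReal_nonneg _ _ _) (h0 t))]
        exact mul_le_of_le_one_left (h0 t) (gaussianPDFReal_zero_one_le_one t))
  refine ⟨integrable_gaussianReal_iff.2 hi', ?_⟩
  rw [← he, integral_gaussianReal_eq_integral_smul one_ne_zero]
  exact integral_mono hi' hi fun t ↦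
    mul_le_of_le_one_left (h0 t) (gaussianPDFReal_zero_one_le_one t)

lemma norm_riemannZeta_le {s : ℂ} (hs : 1 / 2 ≤ s.re) (hs1 : s ≠ 1) :
    ‖riemannZeta s‖ ≤ ‖s - 1‖⁻¹ + (1 + 2 * ‖s‖) := by
  rw [riemannZeta_eq_inv_sub_add hs1, ← norm_inv]
  exact (norm_add_le _ _).trans (by gcongr; exact norm_riemannZeta₀_le hs)

lemma rpow_add_le_two_rpow_mul {a b p : ℝ} (ha : 0 ≤ a) (hb : 0 ≤ b) (hp : 1 ≤ p) :
    (a + b) ^ p ≤ 2 ^ (p - 1) * (a ^ p + b ^ p) := by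
  lift a to NNReal using ha
  lift b to NNReal using hb
  exact_mod_cast NNReal.rpow_add_le_mul_rpow_add_rpow a b hp

lemma norm_riemannZeta_rpow_le {σ : ℝ} (hσ : 1 < σ) (hσ2 : σ ≤ 2) {p : ℝ} (hp : 1 ≤ p) (t : ℝ) :
    ‖riemannZeta (σ + t * Complex.I)‖ ^ p
      ≤ 2 ^ (p - 1) * (2 ^ p * (σ - 1 + |t|) ^ (-p) + (5 + 2 * |t|) ^ p) := by
  have hη : 0 < σ - 1 := by linarith
  have hd : (σ - 1 + |t|) / 2 ≤ ‖(σ + t * Complex.I : ℂ) - 1‖ := by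
    have h1 := Complex.abs_re_le_norm ((σ + t * Complex.I : ℂ) - 1)
    have h2 := Complex.abs_im_le_norm ((σ + t * Complex.I : ℂ) - 1)
    simp at h1 h2
    linarith [le_abs_self (σ - 1)]
  have hd0 : 0 < (σ - 1 + |t|) / 2 := by positivity
  have hz : ‖riemannZeta (σ + t * Complex.I)‖ ≤ ((σ - 1 + |t|) / 2)⁻¹ + (5 + 2 * |t|) := by
    refine (norm_riemannZeta_le (by simp; linarith) fun h ↦ ?_).trans ?_
    · simpa [h] using hd0.trans_le hd
    · refine add_le_add (inv_anti₀ hd0 hd) ?_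
      have : ‖(σ + t * Complex.I : ℂ)‖ ≤ σ + |t| := by
        refine (norm_add_le _ _).trans ?_
        simp [abs_of_pos (zero_lt_one.trans hσ)]
      linarith
  calc ‖riemannZeta (σ + t * Complex.I)‖ ^ p
      ≤ (((σ - 1 + |t|) / 2)⁻¹ + (5 + 2 * |t|)) ^ p := by gcongr
    _ ≤ 2 ^ (p - 1) * (((σ - 1 + |t|) / 2)⁻¹ ^ p + (5 + 2 * |t|) ^ p) :=
        rpow_add_le_two_rpow_mul (by positivity) (by positivity) hp
    _ = _ := by
        rw [inv_div, Real.div_rpow (by positivity) (by positivity),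
          Real.rpow_neg (by positivity), div_eq_mul_inv]

/-- Gaussian moments of `ζ` near the pole. -/
lemma exists_integral_norm_riemannZeta_rpow_le {p : ℝ} (hp : 1 < p) :
    ∃ K, ∀ σ : ℝ, 1 < σ → σ ≤ 2 →
      ∫ t, ‖riemannZeta (σ + (t : ℝ) * Complex.I)‖ ^ p ∂gaussianReal 0 1
        ≤ K * (σ - 1) ^ (1 - p) := by
  set J := ∫ t : ℝ, (1 + ‖t‖) ^ (-p)
  set M := ∫ t : ℝ, (5 + 2 * |t|) ^ p ∂gaussianReal 0 1
  have hM : Integrable (fun t : ℝ ↦ (5 + 2 * |t|) ^ p) (gaussianReal 0 1) := by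
    have hid : MemLp (fun t : ℝ ↦ t) (ENNReal.ofReal p) (gaussianReal 0 1) :=
      memLp_id_gaussianReal' _ ENNReal.ofReal_ne_top
    have h : MemLp (fun t : ℝ ↦ 5 + 2 * |t|) (ENNReal.ofReal p) (gaussianReal 0 1) :=
      (memLp_const (5 : ℝ)).add (hid.abs.const_mul 2)
    have h' := h.integrable_norm_rpow (by simpa using by linarith) ENNReal.ofReal_ne_top
    rw [ENNReal.toReal_ofReal (by linarith)] at h'
    refine h'.congr (ae_of_all _ fun t ↦ ?_)
    simp only
    rw [Real.norm_of_nonneg (by positivity)]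
  refine ⟨2 ^ (p - 1) * (2 ^ p * J + M), fun σ hσ hσ2 ↦ ?_⟩
  obtain ⟨hi, hle⟩ := integral_add_abs_rpow_neg_gaussianReal_le hp (sub_pos.2 hσ)
  have h1 : 1 ≤ (σ - 1) ^ (1 - p) :=
    Real.one_le_rpow_of_pos_of_le_one_of_nonpos (by linarith) (by linarith) (by linarith)
  have hM0 : 0 ≤ M := integral_nonneg fun t ↦ by simp only [Pi.zero_apply]; positivity
  calc _ ≤ ∫ t, 2 ^ (p - 1) * (2 ^ p * (σ - 1 + |t|) ^ (-p) + (5 + 2 * |t|) ^ p)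
          ∂gaussianReal 0 1 :=
        integral_mono_of_nonneg (ae_of_all _ fun t ↦ by simp only [Pi.zero_apply]; positivity)
          (((hi.const_mul _).add hM).const_mul _)
          (ae_of_all _ fun t ↦ norm_riemannZeta_rpow_le hσ hσ2 hp.le t)
    _ = 2 ^ (p - 1) * (2 ^ p * ∫ t, (σ - 1 + |t|) ^ (-p) ∂gaussianReal 0 1 + M) := by
        rw [MeasureTheory.integral_const_mul, MeasureTheory.integral_add (hi.const_mul _) hM,
          MeasureTheory.integral_const_mul]
    _ ≤ 2 ^ (p - 1) * (2 ^ p * ((σ - 1) ^ (1 - p) * J) + M * (σ - 1) ^ (1 - p)) := by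
        gcongr
        exact le_mul_of_one_le_right hM0 h1
    _ = _ := by ring

/-- Negative moments of `ζ` in short intervals to the right of the line `Re s = 1`. -/
lemma exists_intervalIntegral_norm_riemannZeta_rpow_neg_le {p : ℝ} (hp : 1 < p) {δ : ℝ}
    (hδ : 0 ≤ δ) :
    ∃ K, ∀ σ : ℝ, 1 < σ → σ ≤ 2 → ∀ T : ℝ,
      ∫ t in T..(T + δ), ‖riemannZeta (σ + t * Complex.I)‖ ^ (-p) ≤ K * (σ - 1) ^ (1 - p) := by
  obtain ⟨K, hK⟩ := exists_integral_norm_riemannZeta_rpow_le hp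
  refine ⟨√(2 * Real.pi) * Real.exp (δ ^ 2 / 2) * K, fun σ hσ hσ2 T ↦ ?_⟩
  obtain ⟨hi, hle⟩ := integral_norm_riemannZeta_rpow_neg_le
    (norm_charFun_gaussianReal_zero_le_re 1) hσ (zero_le_one.trans hp.le) T
  have h := intervalIntegral_le_integral_gaussianReal hδ
    (fun t ↦ by simp only [Pi.zero_apply]; positivity) hi
  rw [intervalIntegral.integral_comp_add_left
    (fun t : ℝ ↦ ‖riemannZeta (σ + t * Complex.I)‖ ^ (-p)), add_zero] at h
  refine h.trans ?_
  rw [mul_assoc _ K]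
  gcongr
  exact hle.trans (hK σ hσ hσ2)

end GaussianAverage

section ZetaToTheLeft

/-- **Hadamard three-circles theorem**. -/
lemma norm_le_interp_of_norm_le_on_circles {f : ℂ → ℂ} {c z : ℂ} {r R R' a b : ℝ} (hr : 0 < r)
    (hrR : r < R) (hR : R < R') (hf : DifferentiableOn ℂ f (Metric.ball c R'))
    (ha : ∀ w, ‖w - c‖ = r → ‖f w‖ ≤ a) (hb : ∀ w, ‖w - c‖ = R → ‖f w‖ ≤ b)
    (hz : r ≤ ‖z - c‖) (hz' : ‖z - c‖ ≤ R) :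
    ‖f z‖ ≤ a ^ (1 - (Real.log ‖z - c‖ - Real.log r) / (Real.log R - Real.log r)) *
      b ^ ((Real.log ‖z - c‖ - Real.log r) / (Real.log R - Real.log r)) := by
  have hR0 : 0 < R := hr.trans hrR
  have hzc : z - c ≠ 0 := norm_pos_iff.1 (hr.trans_le hz)
  have hnorm (w : ℂ) : ‖c + Complex.exp w - c‖ = Real.exp w.re := by
    rw [add_sub_cancel_left, Complex.norm_exp]
  have hexp {w : ℂ} (hw : w.re ≤ Real.log R) : ‖c + Complex.exp w - c‖ ≤ R := by
    rwa [hnorm, ← Real.le_log_iff_exp_le hR0]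
  have hclos : closure (Complex.HadamardThreeLines.verticalStrip (Real.log r) (Real.log R)) ⊆
      Complex.HadamardThreeLines.verticalClosedStrip (Real.log r) (Real.log R) :=
    closure_minimal (Set.preimage_mono Set.Ioo_subset_Icc_self)
      (isClosed_Icc.preimage Complex.continuous_re)
  have hd : DiffContOnCl ℂ (fun w ↦ f (c + Complex.exp w))
      (Complex.HadamardThreeLines.verticalStrip (Real.log r) (Real.log R)) :=
    DifferentiableOn.diffContOnCl <| hf.comp (by fun_prop) fun w hw ↦
      mem_ball_iff_norm.2 ((hexp (hclos hw).2).trans_lt hR)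
  have hB : BddAbove ((norm ∘ fun w ↦ f (c + Complex.exp w)) ''
      Complex.HadamardThreeLines.verticalClosedStrip (Real.log r) (Real.log R)) := by
    obtain ⟨B, hB⟩ := (isCompact_closedBall c R).exists_bound_of_continuousOn
      (hf.continuousOn.mono (Metric.closedBall_subset_ball hR))
    refine ⟨B, ?_⟩
    rintro _ ⟨w, hw, rfl⟩
    exact hB _ (mem_closedBall_iff_norm.2 (hexp hw.2))
  have key := Complex.HadamardThreeLines.norm_le_interp_of_mem_verticalClosedStrip'
    (f := fun w ↦ f (c + Complex.exp w)) (z := Complex.log (z - c))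
    (Real.log_lt_log hr hrR) (a := a) (b := b)
    ⟨by rw [Complex.log_re]; exact Real.log_le_log hr hz,
      by rw [Complex.log_re]; exact Real.log_le_log (hr.trans_le hz) hz'⟩ hd hB
    (fun w hw ↦ ha _ (by rw [hnorm, show w.re = _ from hw, Real.exp_log hr]))
    (fun w hw ↦ hb _ (by rw [hnorm, show w.re = _ from hw, Real.exp_log hR0]))
  simpa [Complex.exp_log hzc, Complex.log_re] using key

lemma differentiableAt_logDeriv_riemannZeta {s : ℂ} (hs : s ≠ 1) (h0 : riemannZeta s ≠ 0) :
    DifferentiableAt ℂ (fun s ↦ deriv riemannZeta s / riemannZeta s) s := by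
  have hd : DifferentiableOn ℂ riemannZeta {1}ᶜ := fun w hw ↦
    (differentiableAt_riemannZeta hw).differentiableWithinAt
  exact ((hd.deriv isOpen_compl_singleton).differentiableAt
    (isOpen_compl_singleton.mem_nhds hs)).div (differentiableAt_riemannZeta hs) h0

lemma exists_norm_logDeriv_riemannZeta_ofReal_le :
    ∃ A, ∀ σ : ℝ, 1 < σ → σ ≤ 4 →
      ‖deriv riemannZeta σ / riemannZeta σ‖ ≤ A / (σ - 1) := by
  have h1 (σ : ℝ) (hσ : 1 ≤ σ) : riemannZeta₁ σ ≠ 0 := by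
    rcases hσ.eq_or_lt with rfl | hσ
    · simp [riemannZeta₁_one]
    have hσ1 : (σ : ℂ) ≠ 1 := by exact_mod_cast hσ.ne'
    have := riemannZeta_ne_zero_of_one_le_re (s := σ) (by simpa using hσ.le)
    rw [riemannZeta_eq_inv_sub_mul hσ1] at this
    exact right_ne_zero_of_mul this
  have hc : ContinuousOn (fun σ : ℝ ↦ deriv riemannZeta₁ σ / riemannZeta₁ σ) (Set.Icc 1 4) := by
    refine ContinuousOn.div ?_ ?_ fun σ hσ ↦ h1 σ hσ.1
    · exact (differentiable_riemannZeta₁.deriv.continuous.comp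
        Complex.continuous_ofReal).continuousOn
    · exact (differentiable_riemannZeta₁.continuous.comp Complex.continuous_ofReal).continuousOn
  obtain ⟨B, hB⟩ := isCompact_Icc.exists_bound_of_continuousOn hc
  refine ⟨1 + 3 * B, fun σ hσ hσ4 ↦ ?_⟩
  have hσ1 : (σ : ℂ) ≠ 1 := by exact_mod_cast hσ.ne'
  have hpos : 0 < σ - 1 := by linarith
  have hs : (σ : ℂ) - 1 ≠ 0 := sub_ne_zero.2 hσ1
  have h : deriv riemannZeta σ / riemannZeta σ
      = -((σ : ℂ) - 1)⁻¹ + deriv riemannZeta₁ σ / riemannZeta₁ σ := by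
    have := h1 σ hσ.le
    rw [deriv_riemannZeta_eq_neg_inv_sub_sq_mul_add hσ1, riemannZeta_eq_inv_sub_mul hσ1]
    field_simp
  have hB' := hB σ ⟨hσ.le, hσ4⟩
  have hB0 := (norm_nonneg _).trans hB'
  rw [h]
  refine (norm_add_le _ _).trans ?_
  rw [norm_neg, norm_inv, show ((σ : ℂ) - 1) = ((σ - 1 : ℝ) : ℂ) by push_cast; rfl,
    Complex.norm_real, Real.norm_of_nonneg hpos.le, le_div_iff₀ hpos, add_mul,
    inv_mul_cancel₀ hpos.ne']
  have := mul_le_mul hB' (show σ - 1 ≤ 3 by linarith) hpos.le hB0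
  linarith

lemma norm_logDeriv_riemannZeta_le {s : ℂ} (hs : 1 < s.re) :
    ‖deriv riemannZeta s / riemannZeta s‖ ≤ ‖deriv riemannZeta s.re / riemannZeta s.re‖ := by
  have hs' : 1 < (s.re : ℂ).re := by simpa
  rw [← norm_neg, ← norm_neg (_ / riemannZeta s.re), ← neg_div, ← neg_div,
    ← ArithmeticFunction.LSeries_vonMangoldt_eq_deriv_riemannZeta_div hs,
    ← ArithmeticFunction.LSeries_vonMangoldt_eq_deriv_riemannZeta_div hs']
  set f : ℕ → ℂ := fun n ↦ ArithmeticFunction.vonMangoldt n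
  have hf := ArithmeticFunction.LSeriesSummable_vonMangoldt hs
  have hterm (n : ℕ) : LSeries.term f s.re n = (‖LSeries.term f s n‖ : ℝ) := by
    rcases eq_or_ne n 0 with rfl | hn
    · simp
    rw [LSeries.norm_term_eq, if_neg hn, LSeries.term_of_ne_zero hn, Complex.norm_real,
      Real.norm_of_nonneg ArithmeticFunction.vonMangoldt_nonneg, Complex.ofReal_div,
      Complex.ofReal_cpow (Nat.cast_nonneg n), Complex.ofReal_natCast]
  calc ‖LSeries f s‖ ≤ ∑' n, ‖LSeries.term f s n‖ := norm_tsum_le_tsum_norm hf.norm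
    _ ≤ ‖((∑' n, ‖LSeries.term f s n‖ : ℝ) : ℂ)‖ := by
      rw [Complex.norm_real]; exact Real.le_norm_self _
    _ = ‖LSeries f s.re‖ := by rw [Complex.ofReal_tsum, LSeries]; simp_rw [hterm]

lemma exists_norm_logDeriv_riemannZeta_le :
    ∃ A, 1 ≤ A ∧ ∀ s : ℂ, 1 < s.re → s.re ≤ 4 →
      ‖deriv riemannZeta s / riemannZeta s‖ ≤ A / (s.re - 1) := by
  obtain ⟨A, hA⟩ := exists_norm_logDeriv_riemannZeta_ofReal_le
  refine ⟨max A 1, le_max_right _ _, fun s hs hs4 ↦ ?_⟩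
  refine (norm_logDeriv_riemannZeta_le hs).trans ((hA _ hs hs4).trans ?_)
  exact div_le_div_of_nonneg_right (le_max_left _ _) (by linarith)

lemma exists_le_norm_riemannZeta {σ : ℝ} (hσ : 1 < σ) :
    ∃ m > 0, ∀ t : ℝ, m ≤ ‖riemannZeta (σ + t * Complex.I)‖ := by
  set f : ℕ → ℂ := fun n ↦ ArithmeticFunction.vonMangoldt n / Real.log n
  have hs : LSeriesSummable f σ := lSeriesSummable_vonMangoldt_div_log hσ
  refine ⟨Real.exp (-‖lSeriesBCF f σ‖), Real.exp_pos _, fun t ↦ ?_⟩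
  have h := riemannZeta_eq_exp_LSeries (s := σ + t * Complex.I) (by simpa)
  rw [← h, ← lSeriesBCF_apply hs, Complex.norm_exp, Real.exp_le_exp]
  exact (neg_le_neg (BoundedContinuousFunction.norm_coe_le_norm _ t)).trans
    (neg_le_of_abs_le (Complex.abs_re_le_norm _))

end ZetaToTheLeft

section UnderRH

lemma riemannZeta_ne_zero_of_riemannHypothesis (hRH : RiemannHypothesis) {s : ℂ}
    (hs : 1 / 2 < s.re) (him : s.im ≠ 0) : riemannZeta s ≠ 0 := fun h ↦ by
  refine hs.ne' (hRH s h ?_ ?_)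
  · rintro ⟨n, rfl⟩
    exact him (by simp)
  · rintro rfl
    exact him (by simp)

/-- Under the Riemann hypothesis, `ζ` has a logarithm in discs to the right of the critical line,
of size `O (log t)` in slightly smaller discs. -/
lemma exists_log_riemannZeta_of_riemannHypothesis (hRH : RiemannHypothesis) :
    ∃ B, 1 ≤ B ∧ ∀ t : ℝ, 4 ≤ t → ∃ L : ℂ → ℂ,
      (∀ w ∈ Metric.ball (2 + t * Complex.I) (3 / 2),
        HasDerivAt L (deriv riemannZeta w / riemannZeta w) w ∧
        riemannZeta w = riemannZeta (2 + t * Complex.I) * Complex.exp (L w)) ∧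
      ∀ w, ‖w - (2 + t * Complex.I)‖ ≤ 7 / 5 → ‖L w‖ ≤ B * Real.log t := by
  obtain ⟨m, hm, hm'⟩ := exists_le_norm_riemannZeta (σ := 2) (by norm_num)
  set M := 1 + |Real.log (5 / m)|
  have hM : 1 ≤ M := le_add_of_nonneg_right (abs_nonneg _)
  refine ⟨28 * M, by linarith, fun t ht ↦ ?_⟩
  have hlog : 1 ≤ Real.log t := by
    rw [Real.le_log_iff_exp_le (by linarith)]
    linarith [Real.exp_one_lt_three]
  set c : ℂ := 2 + t * Complex.I with hc
  have hcm : m ≤ ‖riemannZeta c‖ := by simpa using hm' t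
  have hcre : c.re = 2 := by simp [hc]
  have hcim : c.im = t := by simp [hc]
  have hball {w : ℂ} (hw : w ∈ Metric.ball c (3 / 2)) :
      1 / 2 < w.re ∧ 1 ≤ w.im ∧ ‖w‖ ≤ t + 7 / 2 ∧ 1 ≤ ‖w - 1‖ := by
    have hw' := mem_ball_iff_norm.1 hw
    have h1 := (abs_lt.1 ((Complex.abs_re_le_norm (w - c)).trans_lt hw')).1
    have h2 := (abs_lt.1 ((Complex.abs_im_le_norm (w - c)).trans_lt hw')).1
    rw [Complex.sub_re, hcre] at h1
    rw [Complex.sub_im, hcim] at h2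
    refine ⟨by linarith, by linarith, ?_, ?_⟩
    · have h3 : ‖c‖ ≤ 2 + t := by
        refine (norm_add_le _ _).trans ?_
        simp [abs_of_nonneg (show 0 ≤ t by linarith)]
      linarith [norm_le_norm_add_norm_sub' w c]
    · have h4 := Complex.abs_im_le_norm (w - 1)
      rw [Complex.sub_im, Complex.one_im, sub_zero] at h4
      linarith [le_abs_self w.im]
  have hne {w : ℂ} (hw : w ∈ Metric.ball c (3 / 2)) : riemannZeta w ≠ 0 :=
    riemannZeta_ne_zero_of_riemannHypothesis hRH (hball hw).1 (by linarith [(hball hw).2.1])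
  have hne1 {w : ℂ} (hw : w ∈ Metric.ball c (3 / 2)) : w ≠ 1 := by
    rintro rfl
    have := (hball hw).2.1
    norm_num at this
  have hcb : c ∈ Metric.ball c (3 / 2) := Metric.mem_ball_self (by norm_num)
  obtain ⟨L, hLc, hL⟩ := (DifferentiableOn.isExactOn_ball (c := c) (r := 3 / 2)
    (f := fun s ↦ deriv riemannZeta s / riemannZeta s) fun w hw ↦
      (differentiableAt_logDeriv_riemannZeta (hne1 hw)
        (hne hw)).differentiableWithinAt).with_val_at c 0
  have hexp {w : ℂ} (hw : w ∈ Metric.ball c (3 / 2)) :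
      riemannZeta w = riemannZeta c * Complex.exp (L w) := by
    have hd (v : ℂ) (hv : v ∈ Metric.ball c (3 / 2)) :
        HasDerivAt (fun w ↦ riemannZeta w * Complex.exp (-L w)) 0 v := by
      convert! (differentiableAt_riemannZeta (hne1 hv)).hasDerivAt.mul (hL v hv).neg.cexp using 1
      field_simp [hne hv]
      ring
    have hconst := Metric.isOpen_ball.is_const_of_deriv_eq_zero
      (convex_ball c (3 / 2)).isPreconnected
      (fun v hv ↦ (hd v hv).differentiableAt.differentiableWithinAt)
      (fun v hv ↦ (hd v hv).deriv) hw hcb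
    simp only [hLc, neg_zero, Complex.exp_zero, mul_one] at hconst
    rw [← hconst, mul_assoc, ← Complex.exp_add, neg_add_cancel, Complex.exp_zero, mul_one]
  have hre {w : ℂ} (hw : w ∈ Metric.ball c (3 / 2)) : (L w).re ≤ M * Real.log t := by
    have h1 : ‖riemannZeta w‖ ≤ 5 * t := by
      obtain ⟨h2, -, h3, h4⟩ := hball hw
      have := norm_riemannZeta_le h2.le (hne1 hw)
      have := inv_le_one_of_one_le₀ h4
      linarith
    rw [hexp hw, norm_mul, Complex.norm_exp] at h1
    have h2 : Real.exp (L w).re ≤ 5 / m * t := by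
      rw [div_mul_eq_mul_div, le_div_iff₀' hm]
      exact (mul_le_mul_of_nonneg_right hcm (Real.exp_nonneg _)).trans h1
    have h3 := (Real.le_log_iff_exp_le (by positivity)).2 h2
    rw [Real.log_mul (by positivity) (by positivity)] at h3
    have h4 := le_mul_of_one_le_right (abs_nonneg (Real.log (5 / m))) hlog
    have h5 := le_abs_self (Real.log (5 / m))
    simp only [M]
    linarith
  refine ⟨L, fun w hw ↦ ⟨hL w hw, hexp hw⟩, fun w hw ↦ ?_⟩
  have hmaps {z : ℂ} (hz : z ∈ Metric.ball (0 : ℂ) (3 / 2)) : c + z ∈ Metric.ball c (3 / 2) := by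
    simpa using hz
  have key := Complex.borelCaratheodory_zero (f := fun z ↦ L (c + z)) (z := w - c) (R := 3 / 2)
    (M := M * Real.log t) (by positivity)
    (fun z hz ↦ ((hL _ (hmaps hz)).comp_const_add c z).differentiableAt.differentiableWithinAt)
    (fun z hz ↦ hre (hmaps hz)) (by norm_num) (by rw [mem_ball_zero_iff]; linarith)
    (by simpa using hLc)
  simp only [add_sub_cancel] at key
  refine key.trans ((div_le_iff₀ (by linarith)).2 ?_)
  have hMt : 0 ≤ M * Real.log t := by positivity
  nlinarith

/-- Under the Riemann hypothesis, `1 / ζ` on the line `Re s = 1` is controlled by its values at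
distance `1 / log log t` to the right. -/
lemma exists_inv_norm_riemannZeta_le_of_riemannHypothesis (hRH : RiemannHypothesis) :
    ∃ C > 0, ∀ t y : ℝ, 4 ≤ t → 10 ≤ y → Real.log (Real.log t) ≤ y + 1 →
      ‖riemannZeta (1 + t * Complex.I)‖⁻¹
        ≤ C * ‖riemannZeta ((1 + y⁻¹ : ℝ) + t * Complex.I)‖⁻¹ := by
  obtain ⟨B, hB1, hB⟩ := exists_log_riemannZeta_of_riemannHypothesis hRH
  obtain ⟨A, hA1, hA⟩ := exists_norm_logDeriv_riemannZeta_le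
  refine ⟨Real.exp (A * Real.exp (10 * (Real.log (2 * B) + 2))), Real.exp_pos _,
    fun t y ht hy hty ↦ ?_⟩
  obtain ⟨L, hL, hLB⟩ := hB t ht
  set c : ℂ := 2 + t * Complex.I with hc
  set h := y⁻¹ with hh
  have hy0 : 0 < y := by linarith
  have hh0 : 0 < h := inv_pos.2 hy0
  have hyh : h * y = 1 := inv_mul_cancel₀ hy0.ne'
  have hh1 : h ≤ 1 / 10 := by
    rw [hh, one_div]
    exact inv_anti₀ (by norm_num) hy
  have hnh : ‖(h : ℂ)‖ = h := by rw [Complex.norm_real, Real.norm_of_nonneg hh0.le]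
  have hlog : 1 ≤ Real.log t := by
    rw [Real.le_log_iff_exp_le (by linarith)]
    linarith [Real.exp_one_lt_three]
  have hadd (w : ℂ) : ‖w + h - c‖ ≤ ‖w - c‖ + h := by
    rw [add_sub_right_comm]
    exact (norm_add_le _ _).trans_eq (by rw [hnh])
  have hmem {w : ℂ} (hw : ‖w - c‖ < 3 / 2) : w ∈ Metric.ball c (3 / 2) := mem_ball_iff_norm.2 hw
  have hdiff : DifferentiableOn ℂ (fun w ↦ L (w + h) - L w) (Metric.ball c (7 / 5)) := fun w hw ↦ by
    have hw' := mem_ball_iff_norm.1 hw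
    exact ((hL _ (hmem ((hadd w).trans_lt (by linarith)))).1.comp_add_const w
      (h : ℂ)).differentiableAt.sub (hL w (hmem (by linarith))).1.differentiableAt
      |>.differentiableWithinAt
  have hout (w : ℂ) (hw : ‖w - c‖ = 5 / 4) : ‖L (w + h) - L w‖ ≤ 2 * B * Real.log t := by
    have h1 := hLB w (by linarith)
    have h2 := hLB (w + h) ((hadd w).trans (by linarith))
    linarith [norm_sub_le (L (w + h)) (L w)]
  have hin (w : ℂ) (hw : ‖w - c‖ = 1 - h) : ‖L (w + h) - L w‖ ≤ A := by
    have hwre : 1 + h ≤ w.re := by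
      have := neg_le_of_abs_le (Complex.abs_re_le_norm (w - c))
      rw [hw] at this
      simp [hc] at this
      linarith
    have hconv : Convex ℝ (Metric.ball c (3 / 2) ∩ {z | 1 + h ≤ z.re}) :=
      (convex_ball c _).inter (convex_halfSpace_re_ge _)
    have key := hconv.norm_image_sub_le_of_norm_hasDerivWithin_le (f := L)
      (f' := fun z ↦ deriv riemannZeta z / riemannZeta z) (x := w) (y := w + h) (C := A / h)
      (fun z hz ↦ (hL z hz.1).1.hasDerivWithinAt) (fun z hz ↦ ?_) ⟨hmem (by linarith), hwre⟩
      ⟨hmem ((hadd w).trans_lt (by linarith)), by simp; linarith⟩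
    · rwa [add_sub_cancel_left, hnh, div_mul_cancel₀ _ hh0.ne'] at key
    · have hz1 : 1 + h ≤ z.re := hz.2
      have hz2 := le_of_abs_le ((Complex.abs_re_le_norm _).trans (mem_ball_iff_norm.1 hz.1).le)
      simp [hc] at hz2
      refine (hA z (by linarith) (by linarith)).trans ?_
      exact div_le_div_of_nonneg_left (by linarith) hh0 (by linarith)
  set z : ℂ := 1 + t * Complex.I with hz
  have hzc : ‖z - c‖ = 1 := by
    rw [hz, hc, add_sub_add_right_eq_sub]
    norm_num
  have key := norm_le_interp_of_norm_le_on_circles (z := z) (by linarith : 0 < 1 - h)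
    (by linarith : 1 - h < 5 / 4) (by norm_num) hdiff hin hout (by linarith) (by linarith)
  rw [hzc, Real.log_one, zero_sub] at key
  set e := -Real.log (1 - h) / (Real.log (5 / 4) - Real.log (1 - h)) with he
  have hlr : Real.log (1 - h) ≤ 0 := Real.log_nonpos (by linarith) (by linarith)
  have hlR : 1 / 5 ≤ Real.log (5 / 4) := by
    have := Real.one_sub_inv_le_log_of_pos (show (0 : ℝ) < 5 / 4 by norm_num)
    norm_num at this ⊢
    linarith
  have he0 : 0 ≤ e := div_nonneg (by linarith) (by linarith)
  have he1 : e ≤ 10 * h := by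
    rw [he, div_le_iff₀ (by linarith)]
    have h1 := Real.one_sub_inv_le_log_of_pos (show 0 < 1 - h by linarith)
    have h2 : (1 - h)⁻¹ ≤ 1 + 2 * h := by
      rw [inv_le_iff_one_le_mul₀ (by linarith)]
      nlinarith
    nlinarith
  have hb : 1 ≤ 2 * B * Real.log t := by nlinarith
  have hlogb : Real.log (2 * B * Real.log t) ≤ Real.log (2 * B) + (y + 1) := by
    rw [Real.log_mul (by linarith) (by linarith)]
    linarith
  have hlB : 0 ≤ Real.log (2 * B) := Real.log_nonneg (by linarith)
  have hbe : (2 * B * Real.log t) ^ e ≤ Real.exp (10 * (Real.log (2 * B) + 2)) := by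
    rw [Real.rpow_def_of_pos (by linarith), Real.exp_le_exp]
    calc Real.log (2 * B * Real.log t) * e
        ≤ (Real.log (2 * B) + (y + 1)) * (10 * h) := by gcongr
      _ ≤ (Real.log (2 * B) * y + 2 * y) * (10 * h) := by
        gcongr
        · exact le_mul_of_one_le_right hlB (by linarith)
        · linarith
      _ = 10 * (Real.log (2 * B) + 2) * (h * y) := by ring
      _ = _ := by rw [hyh, mul_one]
  have hAe : A ^ (1 - e) ≤ A :=
    (Real.rpow_le_rpow_of_exponent_le hA1 (by linarith)).trans_eq (Real.rpow_one A)
  have hD : (L (z + h) - L z).re ≤ A * Real.exp (10 * (Real.log (2 * B) + 2)) :=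
    (Complex.re_le_norm _).trans (key.trans (by gcongr))
  have hzb := (hL z (hmem (by linarith))).2
  have hzhb := (hL (z + h) (hmem ((hadd z).trans_lt (by linarith)))).2
  have hquot : riemannZeta (z + h) = riemannZeta z * Complex.exp (L (z + h) - L z) := by
    rw [hzb, hzhb, mul_assoc, ← Complex.exp_add, add_sub_cancel]
  have hzh : ((1 + h : ℝ) + t * Complex.I : ℂ) = z + h := by
    rw [hz]
    push_cast
    ring
  rw [hzh, hquot, norm_mul, Complex.norm_exp, mul_inv, mul_left_comm, ← Real.exp_neg,
    ← Real.exp_add]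
  exact le_mul_of_one_le_right (by positivity) (Real.one_le_exp (by linarith))

lemma continuous_norm_riemannZeta_rpow {σ : ℝ} (hσ : 1 < σ) (p : ℝ) :
    Continuous fun t : ℝ ↦ ‖riemannZeta (σ + t * Complex.I)‖ ^ p := by
  refine continuous_iff_continuousAt.2 fun t ↦ ?_
  have hre : (σ + t * Complex.I).re = σ := by simp
  have h1 : (σ + t * Complex.I : ℂ) ≠ 1 := fun h ↦ by
    rw [h, Complex.one_re] at hre
    exact hσ.ne hre
  have h0 := riemannZeta_ne_zero_of_one_le_re (s := σ + t * Complex.I) (by rw [hre]; exact hσ.le)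
  exact ((differentiableAt_riemannZeta h1).continuousAt.comp
    (f := fun t : ℝ ↦ (σ + t * Complex.I : ℂ)) (by fun_prop)).norm.rpow_const
    (Or.inl (norm_ne_zero_iff.2 h0))

end UnderRH

theorem stmt_13 (hRH : RiemannHypothesis) (p : ℝ) (hp : 1 < p) (δ : ℝ) (hδ : 0 < δ) :
    ∃ C > (0 : ℝ), ∃ T₀ : ℝ, (16 : ℝ) ≤ T₀ ∧ ∀ T : ℝ, T₀ ≤ T →
      (∫ t in T..(T + δ), ‖riemannZeta (1 + t * Complex.I)‖ ^ (-p)) ≤ C * Real.log (Real.log (Real.log T)) * Real.log (Real.log T) ^ (p - 1) := by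
  obtain ⟨C, hC, hC'⟩ := exists_inv_norm_riemannZeta_le_of_riemannHypothesis hRH
  obtain ⟨K, hK⟩ := exists_intervalIntegral_norm_riemannZeta_rpow_neg_le hp hδ.le
  refine ⟨C ^ p * |K| + 1, by positivity, max (max 16 δ) (Real.exp (Real.exp 10)),
    (le_max_left _ _).trans (le_max_left _ _), fun T hT ↦ ?_⟩
  have hT16 : 16 ≤ T := ((le_max_left _ _).trans (le_max_left _ _)).trans hT
  have hTδ : δ ≤ T := ((le_max_right _ _).trans (le_max_left _ _)).trans hT
  have hT0 : 0 < T := by linarith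
  have hlogT : Real.exp 10 ≤ Real.log T :=
    (Real.le_log_iff_exp_le hT0).2 ((le_max_right _ _).trans hT)
  have hlogT0 : 0 < Real.log T := (Real.exp_pos _).trans_le hlogT
  set y := Real.log (Real.log T) with hy
  have hy10 : 10 ≤ y := (Real.le_log_iff_exp_le hlogT0).2 hlogT
  have hy0 : 0 < y := by linarith
  have hlogy : 1 ≤ Real.log y :=
    (Real.le_log_iff_exp_le hy0).2 (by linarith [Real.exp_one_lt_three])
  have hyinv : y⁻¹ ≤ 1 := inv_le_one_of_one_le₀ (by linarith)
  have hσ : 1 < 1 + y⁻¹ := by linarith [inv_pos.2 hy0]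
  have hpt {t : ℝ} (ht : t ∈ Set.Ioc T (T + δ)) : ‖riemannZeta (1 + t * Complex.I)‖ ^ (-p)
      ≤ C ^ p * ‖riemannZeta ((1 + y⁻¹ : ℝ) + t * Complex.I)‖ ^ (-p) := by
    have hloglog : Real.log (Real.log t) ≤ y + 1 := by
      have h1 : Real.log t ≤ 2 * Real.log T := by
        rw [two_mul, ← Real.log_mul hT0.ne' hT0.ne']
        exact Real.log_le_log (hT0.trans ht.1) (by nlinarith [ht.2])
      have h2 : 0 < Real.log t := Real.log_pos (by linarith [ht.1])
      have h3 := Real.log_le_log h2 h1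
      rw [Real.log_mul two_ne_zero hlogT0.ne'] at h3
      linarith [Real.log_two_lt_d9]
    have h := hC' t y (by linarith [ht.1]) hy10 hloglog
    rw [Real.rpow_neg (norm_nonneg _), Real.rpow_neg (norm_nonneg _),
      ← Real.inv_rpow (norm_nonneg _), ← Real.inv_rpow (norm_nonneg _),
      ← Real.mul_rpow hC.le (by positivity)]
    exact Real.rpow_le_rpow (by positivity) h (by linarith)
  have hle : T ≤ T + δ := by linarith
  calc ∫ t in T..(T + δ), ‖riemannZeta (1 + t * Complex.I)‖ ^ (-p)
      ≤ ∫ t in T..(T + δ), C ^ p * ‖riemannZeta ((1 + y⁻¹ : ℝ) + t * Complex.I)‖ ^ (-p) := by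
        rw [intervalIntegral.integral_of_le hle, intervalIntegral.integral_of_le hle]
        refine integral_mono_of_nonneg
          (ae_of_all _ fun t ↦ by simp only [Pi.zero_apply]; positivity) ?_
          ((ae_restrict_iff' measurableSet_Ioc).2 (ae_of_all _ fun t ht ↦ hpt ht))
        exact (((continuous_norm_riemannZeta_rpow hσ (-p)).const_mul _).intervalIntegrable
          T (T + δ)).1
    _ ≤ C ^ p * (K * (1 + y⁻¹ - 1) ^ (1 - p)) := by
        rw [intervalIntegral.integral_const_mul]
        gcongr
        exact hK _ hσ (by linarith) T
    _ = C ^ p * K * y ^ (p - 1) := by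
        rw [add_sub_cancel_left, Real.inv_rpow hy0.le, ← Real.rpow_neg hy0.le, neg_sub, mul_assoc]
    _ ≤ (C ^ p * |K| + 1) * Real.log y * y ^ (p - 1) := by
        refine mul_le_mul_of_nonneg_right ?_ (by positivity)
        calc C ^ p * K ≤ C ^ p * |K| := by gcongr; exact le_abs_self K
          _ ≤ C ^ p * |K| + 1 := by linarith
          _ ≤ _ := le_mul_of_one_le_right (by positivity) hlogy
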